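/- arXiv:1506.00880 — 4 statements merged into one kernel-verified Lean document; each statement's English description precedes it below -/
import Mathlib

section
/- Let N ≥ 2 and let V be a real orthogonal N×N matrix whose first column is (1/√N)·𝟙_N. Set R = √N·V and R⁻¹ = (1/N)·Rᵀ, with blocks r₁₁, R₁₂, R₂₁, R₂₂ of R⁻¹ as below. Then R₂₁R₂₁ᵀ = R₂₂·(𝟙_{N−1}𝟙_{N−1}ᵀ)·R₂₂ᵀ, the spectral norm satisfies ‖R₂₂‖₂ ≤ 1/√N, and the Frobenius norm of R₂₁ satisfies ‖R₂₁‖ ≤ √((N−1)/N). -/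
open Matrix

noncomputable section

/-- The index `0` of `Fin N` when `N ≥ 2`. -/
def e0 {N : ℕ} (hN : 2 ≤ N) : Fin N := ⟨0, by omega⟩

/-- The embedding `Fin (N-1) → Fin N`, `i ↦ i + 1`. -/
def emb {N : ℕ} (hN : 2 ≤ N) (i : Fin (N - 1)) : Fin N :=
  ⟨i.1 + 1, by have := i.2; omega⟩

/-- Given an orthogonal matrix `V`, `Rinv V = (1/N)·Rᵀ` where `R = √N·V`. -/
def Rinv {N : ℕ} (V : Matrix (Fin N) (Fin N) ℝ) : Matrix (Fin N) (Fin N) ℝ :=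
  (1 / (N : ℝ)) • (Real.sqrt N • V).transpose

/-- The block `R₂₂` of `R⁻¹`: the submatrix obtained by deleting the first row
and first column of `R⁻¹`. -/
def R22 {N : ℕ} (hN : 2 ≤ N) (V : Matrix (Fin N) (Fin N) ℝ) :
    Matrix (Fin (N - 1)) (Fin (N - 1)) ℝ :=
  Matrix.of fun i j => Rinv V (emb hN i) (emb hN j)

/-- The block `R₂₁` of `R⁻¹`: the first column of `R⁻¹` without its first
entry, viewed as a vector. -/
def R21 {N : ℕ} (hN : 2 ≤ N) (V : Matrix (Fin N) (Fin N) ℝ) : Fin (N - 1) → ℝ :=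
  fun i => Rinv V (emb hN i) (e0 hN)

/-- The spectral norm of a real matrix. -/
def specNorm {m n : Type*} [Fintype m] [Fintype n] [DecidableEq n]
    (M : Matrix m n ℝ) : ℝ :=
  ‖LinearMap.toContinuousLinearMap (Matrix.toEuclideanLin M)‖

theorem emb_injective {N : ℕ} (hN : 2 ≤ N) : Function.Injective (emb hN) := by
  intro i j h
  simpa [emb, Fin.ext_iff] using h

theorem emb_ne_e0 {N : ℕ} (hN : 2 ≤ N) (i : Fin (N - 1)) : emb hN i ≠ e0 hN := by
  simp [emb, e0]

theorem sum_eq_e0_add_sum_emb {N : ℕ} (hN : 2 ≤ N) (f : Fin N → ℝ) :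
    ∑ i, f i = f (e0 hN) + ∑ i, f (emb hN i) := by
  obtain ⟨n, rfl⟩ : ∃ n, N = n + 1 := ⟨N - 1, by omega⟩
  exact Fin.sum_univ_succ f

theorem Rinv_apply {N : ℕ} (V : Matrix (Fin N) (Fin N) ℝ) (i j : Fin N) :
    Rinv V i j = V j i / √N := by
  have h : √(N : ℝ) / N = 1 / √N := Real.sqrt_div_self'
  calc Rinv V i j = V j i * (√(N : ℝ) / N) := by
        simp only [Rinv, Matrix.smul_apply, Matrix.transpose_apply, smul_eq_mul]
        ring
    _ = V j i / √N := by rw [h]; ring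

/-- A submatrix of an orthogonal matrix is a contraction for the Euclidean norm. -/
theorem sum_sq_submatrix_mulVec_le {m n p : Type*} [Fintype m] [DecidableEq m] [Fintype n]
    [Fintype p] {U : Matrix m m ℝ} (hU : Uᵀ * U = 1) {f : p → m} {g : n → m}
    (hf : Function.Injective f) (hg : Function.Injective g) (x : n → ℝ) :
    ∑ i, (U.submatrix f g *ᵥ x) i ^ 2 ≤ ∑ j, x j ^ 2 := by
  set y : m → ℝ := Function.extend g x 0
  have hy (j : n) : y (g j) = x j := hg.extend_apply x 0 j
  have hy0 (k : m) (hk : k ∉ Set.range g) : y k = 0 := Function.extend_apply' _ _ _ hk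
  have hmul (i : p) : (U.submatrix f g *ᵥ x) i = (U *ᵥ y) (f i) :=
    Fintype.sum_of_injective g hg _ _ (fun k hk => by simp [hy0 k hk])
      (fun j => by simp [hy])
  have hnorm : (U *ᵥ y) ⬝ᵥ (U *ᵥ y) = y ⬝ᵥ y := by
    rw [Matrix.dotProduct_mulVec, Matrix.vecMul_mulVec, ← Matrix.mulVec_transpose]
    simp [hU]
  calc ∑ i, (U.submatrix f g *ᵥ x) i ^ 2
      = ∑ i, (U *ᵥ y) (f i) ^ 2 := by simp_rw [hmul]
    _ = ∑ k ∈ Finset.univ.map ⟨f, hf⟩, (U *ᵥ y) k ^ 2 := by simp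
    _ ≤ ∑ k, (U *ᵥ y) k ^ 2 :=
        Finset.sum_le_univ_sum_of_nonneg fun _ => sq_nonneg _
    _ = ∑ k, y k ^ 2 := by simpa [dotProduct, ← sq] using hnorm
    _ = ∑ j, x j ^ 2 :=
        (Fintype.sum_of_injective g hg _ _ (fun k hk => by simp [hy0 k hk])
          (fun j => by simp [hy])).symm

theorem specNorm_smul_submatrix_le {m n p : Type*} [Fintype m] [DecidableEq m] [Fintype n]
    [DecidableEq n] [Fintype p] {U : Matrix m m ℝ} (hU : Uᵀ * U = 1) {f : p → m} {g : n → m}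
    (hf : Function.Injective f) (hg : Function.Injective g) {c : ℝ} (hc : 0 ≤ c) :
    specNorm (c • U.submatrix f g) ≤ c := by
  refine ContinuousLinearMap.opNorm_le_bound _ hc fun x => ?_
  have h : ‖Matrix.toEuclideanLin (U.submatrix f g) x‖ ≤ ‖x‖ := by
    rw [← sq_le_sq₀ (norm_nonneg _) (norm_nonneg _), EuclideanSpace.real_norm_sq_eq,
      EuclideanSpace.real_norm_sq_eq]
    exact sum_sq_submatrix_mulVec_le hU hf hg x.ofLp
  rw [map_smul, LinearMap.coe_toContinuousLinearMap', LinearMap.smul_apply, norm_smul,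
    Real.norm_of_nonneg hc]
  gcongr

/-- Let `N ≥ 2` and let `V` be a real orthogonal `N×N` matrix whose first
column is `(1/√N)·𝟙_N`.  Set `R = √N·V`, `R⁻¹ = (1/N)·Rᵀ`, with blocks
`r₁₁, R₁₂, R₂₁, R₂₂` of `R⁻¹`.  Then `R₂₁R₂₁ᵀ = R₂₂·(𝟙𝟙ᵀ)·R₂₂ᵀ`, the spectral
norm of `R₂₂` is at most `1/√N`, and the Frobenius norm of `R₂₁` is at most
`√((N−1)/N)`. -/
theorem stmt_3 {N : ℕ} (hN : 2 ≤ N) (V : Matrix (Fin N) (Fin N) ℝ)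
    (hV : V.transpose * V = 1)
    (hcol : ∀ i : Fin N, V i (e0 hN) = 1 / Real.sqrt N) :
    (∀ i i' : Fin (N - 1),
      R21 hN V i * R21 hN V i' =
        (∑ j : Fin (N - 1), R22 hN V i j) * (∑ j : Fin (N - 1), R22 hN V i' j)) ∧
    specNorm (R22 hN V) ≤ 1 / Real.sqrt N ∧
    Real.sqrt (∑ i : Fin (N - 1), (R21 hN V i) ^ 2) ≤
      Real.sqrt (((N : ℝ) - 1) / N) := by
  have hNpos : (0 : ℝ) < N := by exact_mod_cast (by omega : 0 < N)
  have hsqrt : √(N : ℝ) ≠ 0 := (Real.sqrt_pos.mpr hNpos).ne'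
  have hV' : V * Vᵀ = 1 := mul_eq_one_comm.mp hV
  refine ⟨fun i i' => ?_, ?_, Real.sqrt_le_sqrt ?_⟩
  · have hsum (i : Fin (N - 1)) : ∑ j, R22 hN V i j = -R21 hN V i := by
      have horth : ∑ k, V k (e0 hN) * V k (emb hN i) = 0 := by
        have h := congrFun₂ hV (e0 hN) (emb hN i)
        rwa [Matrix.one_apply_ne (emb_ne_e0 hN i).symm] at h
      simp_rw [hcol, ← Finset.mul_sum] at horth
      have hcolsum := (mul_eq_zero.mp horth).resolve_left (one_div_ne_zero hsqrt)
      rw [sum_eq_e0_add_sum_emb hN] at hcolsum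
      simp only [R22, R21, Matrix.of_apply, Rinv_apply, ← Finset.sum_div]
      rw [eq_neg_of_add_eq_zero_right hcolsum, neg_div]
    rw [hsum, hsum, neg_mul_neg]
  · have hR22 : R22 hN V = (1 / √(N : ℝ)) • Vᵀ.submatrix (emb hN) (emb hN) := by
      ext i j
      simp [R22, Rinv_apply, div_eq_inv_mul]
    rw [hR22]
    exact specNorm_smul_submatrix_le (by simpa using hV') (emb_injective hN)
      (emb_injective hN) (by positivity)
  · have hrow : ∑ k, V (e0 hN) k ^ 2 = 1 := by
      have h := congrFun₂ hV' (e0 hN) (e0 hN)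
      simpa [Matrix.mul_apply, ← sq] using h
    rw [sum_eq_e0_add_sum_emb hN, hcol, div_pow, one_pow, Real.sq_sqrt hNpos.le] at hrow
    have hN2 : (2 : ℝ) ≤ N := by exact_mod_cast hN
    simp only [R21, Rinv_apply, div_pow, Real.sq_sqrt hNpos.le, ← Finset.sum_div]
    gcongr
    have : 0 < 1 / (N : ℝ) := by positivity
    linarith

end
end

section
/- Let N ≥ 2 and let V be a real orthogonal N×N matrix whose first column is (1/√N)·𝟙_N. Set R = √N·V and R⁻¹ = (1/N)·Rᵀ, with blocks r₁₁, R₁₂, R₂₁, R₂₂ of R⁻¹ as below. Then R₂₂ is invertible and N·R₂₂ᵀ = (I_{N−1} + 𝟙_{N−1}𝟙_{N−1}ᵀ)⁻¹ · R₂₂⁻¹; equivalently, the matrix N·R₂₂·(𝟙_{N−1}𝟙_{N−1}ᵀ + I_{N−1})·R₂₂ᵀ equals I_{N−1}. -/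
open Matrix

noncomputable section

/-- The `(N-1)×(N-1)` all-ones matrix `𝟙𝟙ᵀ`. -/
def onesM (k : ℕ) : Matrix (Fin k) (Fin k) ℝ := Matrix.of fun _ _ => 1

theorem R22_apply {N : ℕ} (hN : 2 ≤ N) (V : Matrix (Fin N) (Fin N) ℝ) (i j : Fin (N - 1)) :
    R22 hN V i j = (1 / Real.sqrt N) * V (emb hN j) (emb hN i) := by
  have hpos : (0 : ℝ) < N := by exact_mod_cast (by omega : 0 < N)
  have hs : Real.sqrt N ≠ 0 := (Real.sqrt_pos.mpr hpos).ne'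
  have hsq : Real.sqrt N ^ 2 = N := Real.sq_sqrt hpos.le
  simp only [R22, Rinv, Matrix.of_apply, Matrix.smul_apply, Matrix.transpose_apply, smul_eq_mul]
  field_simp
  rw [hsq]

/-- Every column but the first is orthogonal to the all-ones vector. -/
theorem sum_emb_column {N : ℕ} (hN : 2 ≤ N) (V : Matrix (Fin N) (Fin N) ℝ)
    (hV : V.transpose * V = 1) (hcol : ∀ i : Fin N, V i (e0 hN) = 1 / Real.sqrt N)
    (i : Fin (N - 1)) : ∑ j, V (emb hN j) (emb hN i) = -V (e0 hN) (emb hN i) := by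
  have hpos : (0 : ℝ) < N := by exact_mod_cast (by omega : 0 < N)
  have h := congrFun (congrFun hV (e0 hN)) (emb hN i)
  have hne : e0 hN ≠ emb hN i := by simp [e0, emb, Fin.ext_iff]
  simp only [Matrix.mul_apply, Matrix.transpose_apply, hcol, Matrix.one_apply_ne hne,
    ← Finset.mul_sum] at h
  have h0 := (mul_eq_zero.mp h).resolve_left (by positivity)
  rw [sum_eq_e0_add_sum_emb hN] at h0
  linarith

theorem smul_R22_mul_mul_transpose {N : ℕ} (hN : 2 ≤ N) (V : Matrix (Fin N) (Fin N) ℝ)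
    (hV : V.transpose * V = 1) (hcol : ∀ i : Fin N, V i (e0 hN) = 1 / Real.sqrt N) :
    (N : ℝ) • (R22 hN V * (onesM (N - 1) + 1) * (R22 hN V).transpose) = 1 := by
  have hpos : (0 : ℝ) < N := by exact_mod_cast (by omega : 0 < N)
  have hc : (N : ℝ) * ((1 / Real.sqrt N) * (1 / Real.sqrt N)) = 1 := by
    rw [div_mul_div_comm, Real.mul_self_sqrt hpos.le]
    field_simp
  ext i k
  have h := congrFun (congrFun hV (emb hN i)) (emb hN k)
  have hone : (1 : Matrix (Fin N) (Fin N) ℝ) (emb hN i) (emb hN k) =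
      (1 : Matrix (Fin (N - 1)) (Fin (N - 1)) ℝ) i k := by
    simp [Matrix.one_apply, emb, Fin.ext_iff]
  rw [hone, Matrix.mul_apply, sum_eq_e0_add_sum_emb hN] at h
  simp only [Matrix.transpose_apply] at h
  have hones : (R22 hN V * onesM (N - 1) * (R22 hN V).transpose) i k =
      (∑ j, R22 hN V i j) * ∑ j, R22 hN V k j := by
    simp [Matrix.mul_apply, onesM, Finset.mul_sum]
  rw [Matrix.mul_add, Matrix.mul_one, Matrix.add_mul, Matrix.smul_apply, Matrix.add_apply, hones,
    Matrix.mul_apply, ← h]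
  simp only [Matrix.transpose_apply, R22_apply, ← Finset.mul_sum,
    sum_emb_column hN V hV hcol, smul_eq_mul]
  simp only [mul_mul_mul_comm (1 / Real.sqrt N) _ (1 / Real.sqrt N) _]
  rw [← Finset.mul_sum, ← mul_add, ← mul_assoc, hc]
  ring

/-- Let `N ≥ 2` and let `V` be a real orthogonal `N×N` matrix whose first
column is `(1/√N)·𝟙_N`.  Set `R = √N·V`, `R⁻¹ = (1/N)·Rᵀ`, with blocks
`r₁₁, R₁₂, R₂₁, R₂₂` of `R⁻¹`.  Then `R₂₂` is invertible and
`N·R₂₂ᵀ = (I + 𝟙𝟙ᵀ)⁻¹·R₂₂⁻¹`; equivalently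
`N·R₂₂·(𝟙𝟙ᵀ + I)·R₂₂ᵀ = I`. -/
theorem stmt_4 {N : ℕ} (hN : 2 ≤ N) (V : Matrix (Fin N) (Fin N) ℝ)
    (hV : V.transpose * V = 1)
    (hcol : ∀ i : Fin N, V i (e0 hN) = 1 / Real.sqrt N) :
    IsUnit (R22 hN V) ∧
    (N : ℝ) • (R22 hN V).transpose =
      ((1 : Matrix (Fin (N - 1)) (Fin (N - 1)) ℝ) + onesM (N - 1))⁻¹ * (R22 hN V)⁻¹ ∧
    (N : ℝ) • (R22 hN V * (onesM (N - 1) + 1) * (R22 hN V).transpose) = 1 := by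
  have h := smul_R22_mul_mul_transpose hN V hV hcol
  set A := R22 hN V
  set B := onesM (N - 1) + 1
  have hA : A * (B * ((N : ℝ) • A.transpose)) = 1 := by
    rw [← Matrix.mul_assoc, Matrix.mul_smul, h]
  have hB : B * ((N : ℝ) • A.transpose * A) = 1 := by
    rw [← Matrix.mul_assoc, mul_eq_one_comm.mp hA]
  refine ⟨IsUnit.of_mul_eq_one _ hA, ?_, h⟩
  rw [add_comm, Matrix.inv_eq_right_inv hA, Matrix.inv_eq_right_inv hB, Matrix.mul_assoc,
    hA, Matrix.mul_one]

end
end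

section
/- Consider N ≥ 2 agents with matrices A₁,…,A_N ∈ ℝ^{n×n} and biases b₁,…,b_N ∈ ℝⁿ, and let Â = diag(A₁,…,A_N) ∈ ℝ^{nN×nN}, B = (b₁ᵀ,…,b_Nᵀ)ᵀ ∈ ℝ^{nN}, ℋ = σ·(ℒ_C ⊗ I_n) + σ_P·(ℒ_P ⊗ I_n) with σ ≥ 0, σ_P ≥ 0 and ℒ_C, ℒ_P graph Laplacians, and let ℒ_I be the Laplacian of a connected weighted undirected graph (so its kernel is spanned by 𝟙_N) and σ_I > 0. If Ψ₁₁ := (1/N)·Σ_{k=1}^N A_k is invertible, then there is exactly one pair (x*, z*) ∈ ℝ^{nN} × ℝ^{nN} satisfying (Â − ℋ)x* + z* + B = 0, (ℒ_I ⊗ I_n)x* = 0, and (𝟙_Nᵀ ⊗ I_n)z* = 0; namely x* = 𝟙_N ⊗ x_∞ with x_∞ = −(1/N)·Ψ₁₁⁻¹·Σ_{k=1}^N b_k, and z* = −(Â x* + B). -/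
open Matrix
open scoped Kronecker

noncomputable section

/-- `L` is the Laplacian of a weighted undirected graph on `N` nodes:
`L = diag(𝒜𝟙) − 𝒜` for a symmetric nonnegative weight matrix `𝒜` with zero
diagonal. -/
def IsLaplacian {N : ℕ} (L : Matrix (Fin N) (Fin N) ℝ) : Prop :=
  ∃ A : Matrix (Fin N) (Fin N) ℝ, A.IsSymm ∧ (∀ i j, 0 ≤ A i j) ∧
    (∀ i, A i i = 0) ∧ L = Matrix.diagonal (fun i => ∑ j, A i j) - A

/-- `L` is the Laplacian of a *connected* weighted undirected graph: its
kernel is spanned by the all-ones vector. -/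
def IsConnLaplacian {N : ℕ} (L : Matrix (Fin N) (Fin N) ℝ) : Prop :=
  IsLaplacian L ∧ ∀ v : Fin N → ℝ, L.mulVec v = 0 → ∃ c : ℝ, v = fun _ => c

/-- The block-diagonal matrix `diag(A₁,…,A_N)` acting on `ℝ^{nN}`
(indexed by `Fin N × Fin n`). -/
def blockDiag {N n : ℕ} (A : Fin N → Matrix (Fin n) (Fin n) ℝ) :
    Matrix (Fin N × Fin n) (Fin N × Fin n) ℝ :=
  Matrix.of fun p q => if p.1 = q.1 then A p.1 p.2 q.2 else 0

theorem IsLaplacian.mulVec_const {N : ℕ} {L : Matrix (Fin N) (Fin N) ℝ} (hL : IsLaplacian L)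
    (c : ℝ) : L.mulVec (fun _ => c) = 0 := by
  obtain ⟨A, -, -, -, rfl⟩ := hL
  ext i
  rw [Matrix.sub_mulVec, Pi.sub_apply, Matrix.mulVec_diagonal, Finset.sum_mul]
  exact sub_self _

theorem kronecker_one_mulVec_apply {N n : ℕ} (L : Matrix (Fin N) (Fin N) ℝ)
    (x : Fin N × Fin n → ℝ) (i : Fin N) (j : Fin n) :
    (L ⊗ₖ (1 : Matrix (Fin n) (Fin n) ℝ)).mulVec x (i, j) =
      L.mulVec (fun k => x (k, j)) i := by
  simp [Matrix.mulVec, dotProduct, Fintype.sum_prod_type, Matrix.one_apply]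

/-- `L ⊗ I` annihilates consensus vectors when `L` is a Laplacian. -/
theorem IsLaplacian.kronecker_one_mulVec_consensus {N n : ℕ} {L : Matrix (Fin N) (Fin N) ℝ}
    (hL : IsLaplacian L) (v : Fin n → ℝ) :
    (L ⊗ₖ (1 : Matrix (Fin n) (Fin n) ℝ)).mulVec (fun p : Fin N × Fin n => v p.2) = 0 := by
  ext ⟨i, j⟩
  rw [kronecker_one_mulVec_apply]
  exact congrFun (hL.mulVec_const (v j)) i

/-- The kernel of `L ⊗ I` consists of consensus vectors when `L` is a connected Laplacian. -/
theorem IsConnLaplacian.exists_eq_consensus {N n : ℕ} {L : Matrix (Fin N) (Fin N) ℝ}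
    (hL : IsConnLaplacian L) {x : Fin N × Fin n → ℝ}
    (hx : (L ⊗ₖ (1 : Matrix (Fin n) (Fin n) ℝ)).mulVec x = 0) :
    ∃ v : Fin n → ℝ, x = fun p => v p.2 := by
  have h (j : Fin n) : ∃ c : ℝ, (fun k => x (k, j)) = fun _ => c := by
    refine hL.2 _ (funext fun i => ?_)
    rw [← kronecker_one_mulVec_apply, hx]
    rfl
  choose v hv using h
  exact ⟨v, funext fun p => congrFun (hv p.2) p.1⟩

theorem blockDiag_mulVec_consensus {N n : ℕ} (A : Fin N → Matrix (Fin n) (Fin n) ℝ)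
    (v : Fin n → ℝ) (i : Fin N) (j : Fin n) :
    (_root_.blockDiag A).mulVec (fun p => v p.2) (i, j) = (A i).mulVec v j := by
  simp only [_root_.blockDiag, Matrix.mulVec, dotProduct, Fintype.sum_prod_type, Matrix.of_apply,
    ite_mul, zero_mul]
  rw [Finset.sum_comm]
  simp

/-- The averaged equilibrium equation determines the consensus value. -/
theorem sum_mulVec_add_eq_zero_iff {N n : ℕ} (hN : N ≠ 0)
    (A : Fin N → Matrix (Fin n) (Fin n) ℝ) (b : Fin N → Fin n → ℝ)
    (hinv : IsUnit ((1 / (N : ℝ)) • ∑ k, A k).det) (v : Fin n → ℝ) :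
    (∀ j, ∑ i, ((A i).mulVec v j + b i j) = 0) ↔
      v = -((1 / (N : ℝ)) • (((1 / (N : ℝ)) • ∑ k, A k)⁻¹.mulVec (∑ k, b k))) := by
  have hc : (1 / (N : ℝ)) ≠ 0 := by positivity
  have hsum : (∀ j, ∑ i, ((A i).mulVec v j + b i j) = 0) ↔
      ((1 / (N : ℝ)) • ∑ k, A k).mulVec v = -((1 / (N : ℝ)) • ∑ k, b k) := by
    rw [Matrix.smul_mulVec, ← smul_neg, (smul_right_injective _ hc).eq_iff, Matrix.sum_mulVec,
      eq_neg_iff_add_eq_zero, funext_iff]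
    simp [Finset.sum_add_distrib, Finset.sum_apply]
  rw [hsum, ← Matrix.mulVec_smul, ← Matrix.mulVec_neg]
  constructor
  · intro h
    rw [← h, Matrix.mulVec_mulVec, Matrix.nonsing_inv_mul _ hinv, Matrix.one_mulVec]
  · rintro rfl
    rw [Matrix.mulVec_mulVec, Matrix.mul_nonsing_inv _ hinv, Matrix.one_mulVec]

/-- If `Ψ₁₁ = (1/N)·Σ A_k` is invertible, the multiplex PI closed-loop network
has exactly one equilibrium pair `(x*, z*)` satisfying
`(Â − ℋ)x* + z* + B = 0`, `(ℒ_I ⊗ I_n)x* = 0` and `(𝟙ᵀ ⊗ I_n)z* = 0`;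
namely `x* = 𝟙 ⊗ x_∞` with `x_∞ = −(1/N)·Ψ₁₁⁻¹·Σ b_k` and
`z* = −(Â x* + B)`. -/
theorem stmt_6 {N n : ℕ} (hN : 2 ≤ N) (hn : 1 ≤ n)
    (A : Fin N → Matrix (Fin n) (Fin n) ℝ) (b : Fin N → Fin n → ℝ)
    (σ σP σI : ℝ) (hσ : 0 ≤ σ) (hσP : 0 ≤ σP) (hσI : 0 < σI)
    (LC LP LI : Matrix (Fin N) (Fin N) ℝ)
    (hLC : IsLaplacian LC) (hLP : IsLaplacian LP) (hLI : IsConnLaplacian LI)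
    (hinv : IsUnit ((1 / (N : ℝ)) • ∑ k, A k).det) :
    let Ψ11 : Matrix (Fin n) (Fin n) ℝ := (1 / (N : ℝ)) • ∑ k, A k
    let xinf : Fin n → ℝ := -((1 / (N : ℝ)) • (Ψ11⁻¹.mulVec (∑ k, b k)))
    let xstar : Fin N × Fin n → ℝ := fun p => xinf p.2
    let B : Fin N × Fin n → ℝ := fun p => b p.1 p.2
    let H : Matrix (Fin N × Fin n) (Fin N × Fin n) ℝ :=
      σ • (LC ⊗ₖ (1 : Matrix (Fin n) (Fin n) ℝ)) +
        σP • (LP ⊗ₖ (1 : Matrix (Fin n) (Fin n) ℝ))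
    let zstar : Fin N × Fin n → ℝ := -((blockDiag A).mulVec xstar + B)
    ∀ x z : Fin N × Fin n → ℝ,
      ((blockDiag A - H).mulVec x + z + B = 0 ∧
        (LI ⊗ₖ (1 : Matrix (Fin n) (Fin n) ℝ)).mulVec x = 0 ∧
        (∀ j : Fin n, ∑ i : Fin N, z (i, j) = 0)) ↔
      (x = xstar ∧ z = zstar) := by
  intro Ψ11 xinf xstar B H zstar x z
  have hH (v : Fin n → ℝ) : (_root_.blockDiag A - H).mulVec (fun p => v p.2) =
      (_root_.blockDiag A).mulVec (fun p => v p.2) := by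
    simp [H, Matrix.sub_mulVec, Matrix.add_mulVec, Matrix.smul_mulVec,
      hLC.kronecker_one_mulVec_consensus, hLP.kronecker_one_mulVec_consensus]
  have hxinf (v : Fin n → ℝ) : (∀ j, ∑ i, ((A i).mulVec v j + b i j) = 0) ↔ v = xinf :=
    sum_mulVec_add_eq_zero_iff (by omega) A b hinv v
  have hz (v : Fin n → ℝ) (j : Fin n) :
      ∑ i, (-((_root_.blockDiag A).mulVec (fun p => v p.2) + B)) (i, j) =
        -∑ i, ((A i).mulVec v j + b i j) := by
    simp only [Pi.neg_apply, Pi.add_apply, blockDiag_mulVec_consensus, Finset.sum_neg_distrib, B]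
  constructor
  · rintro ⟨h1, h2, h3⟩
    obtain ⟨v, rfl⟩ := hLI.exists_eq_consensus h2
    have hzv : z = -((_root_.blockDiag A).mulVec (fun p => v p.2) + B) := by
      rw [hH] at h1
      rw [eq_neg_iff_add_eq_zero, ← h1]
      abel
    have hv : v = xinf := by
      refine (hxinf v).1 fun j => ?_
      rw [← neg_eq_zero, ← hz, ← hzv, h3]
    subst hzv
    rw [hv]
    exact ⟨rfl, rfl⟩
  · rintro ⟨rfl, rfl⟩
    refine ⟨?_, hLI.1.kronecker_one_mulVec_consensus xinf, fun j => ?_⟩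
    · rw [hH xinf]
      simp only [zstar, xstar]
      abel
    · rw [hz xinf, (hxinf xinf).2 rfl, neg_zero]

end
end

section
/- Consider N ≥ 2 agents with identical dynamics A_i = A ∈ ℝ^{n×n} for all i, where both A and A + Aᵀ are Hurwitz (all eigenvalues have negative real part; equivalently, A + Aᵀ is negative definite), biases b₁,…,b_N ∈ ℝⁿ, Laplacians ℒ_C, ℒ_P, ℒ_I of connected weighted undirected graphs on N nodes, and any gains σ ≥ 0, σ_P > 0, σ_I > 0. Let Â = I_N ⊗ A, B = (b₁ᵀ,…,b_Nᵀ)ᵀ, ℋ = σ·(ℒ_C ⊗ I_n) + σ_P·(ℒ_P ⊗ I_n). Then for every continuously differentiable pair x : [0,∞) → ℝ^{nN}, z : [0,∞) → ℝ^{nN} satisfying ẋ(t) = (Â − ℋ)x(t) + z(t) + B and ż(t) = −σ_I·(ℒ_I ⊗ I_n)·x(t) with z(0) = 0, the state x(t) converges as t → ∞ to 𝟙_N ⊗ x_∞ with x_∞ = −(1/N)·A⁻¹·Σ_{k=1}^N b_k, and z(t) remains bounded on [0,∞). -/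
open Matrix
open scoped Kronecker

noncomputable section

/-- A real square matrix is Hurwitz if every (complex) eigenvalue has negative
real part. -/
def IsHurwitz {n : ℕ} (M : Matrix (Fin n) (Fin n) ℝ) : Prop :=
  ∀ μ ∈ spectrum ℂ (M.map (Complex.ofReal)), μ.re < 0

open Filter Topology Set

lemma antitoneOn_Ici_of_hasDerivWithinAt {f f' : ℝ → ℝ} {a : ℝ} (ha : 0 ≤ a)
    (hf : ∀ t ∈ Ici (0 : ℝ), HasDerivWithinAt f (f' t) (Ici 0) t)
    (hf' : ∀ t ∈ Ici a, f' t ≤ 0) : AntitoneOn f (Ici a) := by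
  have hsub : Ici a ⊆ Ici (0 : ℝ) := Ici_subset_Ici.2 ha
  refine antitoneOn_of_hasDerivWithinAt_nonpos (convex_Ici a)
    (fun t ht => ((hf t (hsub ht)).mono hsub).continuousWithinAt)
    (fun t ht => (hf t (hsub (interior_subset ht))).mono (interior_subset.trans hsub))
    fun t ht => hf' t (interior_subset ht)

/-- A Barbalat-type lemma: if `V ≥ 0` decreases at rate at least `c * f` and `f'` is bounded
below, then `f` vanishes at infinity. -/
lemma tendsto_zero_of_lyapunov {V f f' V' : ℝ → ℝ} {c K : ℝ} (hc : 0 < c) (hK : 0 < K)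
    (hV0 : ∀ t ∈ Ici (0 : ℝ), 0 ≤ V t) (hf0 : ∀ t ∈ Ici (0 : ℝ), 0 ≤ f t)
    (hV : ∀ t ∈ Ici (0 : ℝ), HasDerivWithinAt V (V' t) (Ici 0) t)
    (hf : ∀ t ∈ Ici (0 : ℝ), HasDerivWithinAt f (f' t) (Ici 0) t)
    (hVf : ∀ t ∈ Ici (0 : ℝ), V' t ≤ -c * f t)
    (hfK : ∀ t ∈ Ici (0 : ℝ), -K ≤ f' t) : Tendsto f atTop (𝓝 0) := by
  have hVanti : AntitoneOn V (Ici 0) := antitoneOn_Ici_of_hasDerivWithinAt le_rfl hV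
    fun t ht => (hVf t ht).trans (by nlinarith [hf0 t ht])
  have hlip : AntitoneOn (fun s => -f s - K * s) (Ici 0) :=
    antitoneOn_Ici_of_hasDerivWithinAt (f' := fun s => -f' s - K * 1) le_rfl
      (fun t ht => (hf t ht).neg.sub ((hasDerivWithinAt_id t _).const_mul K))
      fun t ht => by linarith [hfK t ht]
  have hdrop : ∀ t ∈ Ici (0 : ℝ), ∀ δ : ℝ, 0 ≤ δ →
      c * (f t * δ - K / 2 * δ ^ 2) ≤ V t - V (t + δ) := by
    intro t ht δ hδ
    have hanti : AntitoneOn (fun s => V s + c * (f t * (s - t) - K / 2 * (s - t) ^ 2)) (Ici t) := by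
      refine antitoneOn_Ici_of_hasDerivWithinAt
        (f' := fun s => V' s + c * (f t * 1 - K / 2 * (2 * (s - t) * 1))) ht (fun s hs => ?_)
        fun s hs => ?_
      · have h1 := (hasDerivWithinAt_id s (Ici 0)).sub_const t
        have h2 := h1.pow 2
        simp only [id, Nat.cast_ofNat, pow_one, Nat.add_one_sub_one] at h1 h2
        exact (hV s hs).add (((h1.const_mul (f t)).sub (h2.const_mul (K / 2))).const_mul c)
      · have hs0 : s ∈ Ici (0 : ℝ) := Ici_subset_Ici.2 ht hs
        have h1 : -f s - K * s ≤ -f t - K * t := hlip ht hs0 hs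
        have h2 := hVf s hs0
        nlinarith
    have := hanti self_mem_Ici (show t + δ ∈ Ici t by simpa using hδ) (by linarith)
    simp only [sub_self, add_sub_cancel_left] at this
    linarith
  have hganti : Antitone fun t => V (max t 0) := fun s t hst =>
    hVanti (mem_Ici.2 (le_max_right _ _)) (mem_Ici.2 (le_max_right _ _)) (max_le_max_right 0 hst)
  have hlim := tendsto_atTop_ciInf hganti
    ⟨0, by rintro _ ⟨t, rfl⟩; exact hV0 _ (mem_Ici.2 (le_max_right _ _))⟩
  rw [Metric.tendsto_atTop]
  intro ε hε
  have hδ : 0 < ε / K := div_pos hε hK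
  have hdiff := hlim.sub (hlim.comp (tendsto_atTop_add_const_right atTop (ε / K) tendsto_id))
  rw [sub_self] at hdiff
  obtain ⟨T, hT⟩ := eventually_atTop.1
    (hdiff.eventually (gt_mem_nhds (show 0 < c * (ε / K) * (ε / 2) by positivity)))
  refine ⟨max T 0, fun t ht => ?_⟩
  have ht0 : 0 ≤ t := (le_max_right _ _).trans ht
  have h1 := hT t ((le_max_left _ _).trans ht)
  simp only [Function.comp, id, max_eq_left ht0, max_eq_left (add_nonneg ht0 hδ.le)] at h1
  have h2 := hdrop t ht0 _ hδ.le
  have h3 : c * (f t * (ε / K) - K / 2 * (ε / K) ^ 2) = c * (ε / K) * (f t - ε / 2) := by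
    field_simp
  rw [h3] at h2
  have h4 := lt_of_mul_lt_mul_left (h2.trans_lt h1) (by positivity)
  rw [Real.dist_eq, sub_zero, abs_of_nonneg (hf0 t ht0)]
  linarith

lemma HasDerivWithinAt.dotProduct {ι : Type*} [Fintype ι] {u v : ℝ → ι → ℝ} {u' v' : ι → ℝ}
    {s : Set ℝ} {t : ℝ} (hu : HasDerivWithinAt u u' s t) (hv : HasDerivWithinAt v v' s t) :
    HasDerivWithinAt (fun t => u t ⬝ᵥ v t) (u' ⬝ᵥ v t + u t ⬝ᵥ v') s t := by
  rw [hasDerivWithinAt_pi] at hu hv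
  simp only [_root_.dotProduct, ← Finset.sum_add_distrib]
  exact HasDerivWithinAt.fun_sum fun i _ => (hu i).mul (hv i)

lemma HasDerivWithinAt.const_mulVec {ι κ : Type*} [Fintype ι] [Fintype κ] (M : Matrix κ ι ℝ)
    {u : ℝ → ι → ℝ} {u' : ι → ℝ} {s : Set ℝ} {t : ℝ} (hu : HasDerivWithinAt u u' s t) :
    HasDerivWithinAt (fun t => M *ᵥ u t) (M *ᵥ u') s t :=
  (M.mulVecLin.toContinuousLinearMap.hasFDerivAt.comp_hasDerivWithinAt t hu)

lemma sq_apply_le_dotProduct_self {ι : Type*} [Fintype ι] (v : ι → ℝ) (i : ι) :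
    v i ^ 2 ≤ v ⬝ᵥ v := by
  rw [sq]
  exact Finset.single_le_sum (f := fun i => v i * v i) (fun j _ => mul_self_nonneg _)
    (Finset.mem_univ i)

lemma dotProduct_self_nonneg_real {ι : Type*} [Fintype ι] (v : ι → ℝ) : 0 ≤ v ⬝ᵥ v :=
  Finset.sum_nonneg fun _ _ => mul_self_nonneg _

lemma Matrix.exists_dotProduct_mulVec_le {ι : Type*} [Fintype ι] (Q : Matrix ι ι ℝ) :
    ∃ C : ℝ, 0 ≤ C ∧ ∀ v : ι → ℝ, v ⬝ᵥ Q *ᵥ v ≤ C * (v ⬝ᵥ v) := by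
  refine ⟨∑ i, ∑ j, |Q i j|, by positivity, fun v => ?_⟩
  have hterm : ∀ i j, v i * (Q i j * v j) ≤ |Q i j| * (v ⬝ᵥ v) := fun i j => by
    have hv : |v i * v j| ≤ v ⬝ᵥ v := by
      have h1 := sq_apply_le_dotProduct_self v i
      have h2 := sq_apply_le_dotProduct_self v j
      rw [abs_le]
      constructor <;> nlinarith [sq_nonneg (v i + v j), sq_nonneg (v i - v j)]
    calc v i * (Q i j * v j) = Q i j * (v i * v j) := by ring
      _ ≤ |Q i j| * |v i * v j| := (le_abs_self _).trans (abs_mul _ _).le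
      _ ≤ _ := by gcongr
  calc v ⬝ᵥ Q *ᵥ v = ∑ i, ∑ j, v i * (Q i j * v j) := by
        simp only [_root_.dotProduct, Matrix.mulVec, Finset.mul_sum]
    _ ≤ ∑ i, ∑ j, |Q i j| * (v ⬝ᵥ v) :=
        Finset.sum_le_sum fun i _ => Finset.sum_le_sum fun j _ => hterm i j
    _ = _ := by simp only [Finset.sum_mul]

lemma Matrix.PosDef.exists_pos_mul_dotProduct_le {ι : Type*} [Fintype ι] {Q : Matrix ι ι ℝ}
    (hQ : Q.PosDef) : ∃ c : ℝ, 0 < c ∧ ∀ v : ι → ℝ, c * (v ⬝ᵥ v) ≤ v ⬝ᵥ Q *ᵥ v := by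
  cases isEmpty_or_nonempty ι
  · exact ⟨1, one_pos, fun v => by simp [_root_.dotProduct]⟩
  obtain ⟨u, hu, hmin⟩ := (isCompact_sphere (0 : ι → ℝ) 1).exists_isMinOn
    (NormedSpace.sphere_nonempty.2 zero_le_one)
    (f := fun v : ι → ℝ => v ⬝ᵥ Q *ᵥ v) (by unfold Matrix.mulVec; fun_prop)
  have hupos : 0 < u ⬝ᵥ Q *ᵥ u := hQ.dotProduct_mulVec_pos
    (ne_zero_of_mem_sphere one_ne_zero ⟨u, hu⟩)
  have hcard : (0 : ℝ) < Fintype.card ι := by exact_mod_cast Fintype.card_pos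
  refine ⟨(u ⬝ᵥ Q *ᵥ u) / Fintype.card ι, by positivity, fun v => ?_⟩
  rcases eq_or_ne v 0 with rfl | hv
  · simp
  have hvn : 0 < ‖v‖ := norm_pos_iff.2 hv
  have h1 : u ⬝ᵥ Q *ᵥ u ≤ (‖v‖⁻¹ • v) ⬝ᵥ Q *ᵥ (‖v‖⁻¹ • v) :=
    hmin (by simp [norm_smul, hvn.ne'])
  have h2 : v ⬝ᵥ v ≤ Fintype.card ι * ‖v‖ ^ 2 := by
    have : ∀ i ∈ Finset.univ, v i * v i ≤ ‖v‖ ^ 2 := fun i _ => by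
      rw [← sq, ← sq_abs]
      exact pow_le_pow_left₀ (abs_nonneg _) (norm_le_pi_norm v i) 2
    simpa [_root_.dotProduct] using Finset.sum_le_card_nsmul _ _ _ this
  rw [Matrix.mulVec_smul, smul_dotProduct, dotProduct_smul, smul_eq_mul, smul_eq_mul,
    ← mul_assoc, ← mul_inv, ← sq, inv_mul_eq_div, le_div_iff₀ (by positivity)] at h1
  calc _ ≤ (u ⬝ᵥ Q *ᵥ u) / Fintype.card ι * (Fintype.card ι * ‖v‖ ^ 2) := by gcongr
    _ = u ⬝ᵥ Q *ᵥ u * ‖v‖ ^ 2 := by field_simp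
    _ ≤ _ := h1

lemma IsLaplacian.mulVec_one {N : ℕ} {L : Matrix (Fin N) (Fin N) ℝ} (hL : IsLaplacian L) :
    L *ᵥ 1 = 0 := by
  obtain ⟨A, -, -, -, rfl⟩ := hL
  ext i
  rw [Matrix.sub_mulVec, Pi.sub_apply, Matrix.mulVec_diagonal]
  simp [Matrix.mulVec, _root_.dotProduct]

lemma IsLaplacian.posSemidef {N : ℕ} {L : Matrix (Fin N) (Fin N) ℝ} (hL : IsLaplacian L) :
    L.PosSemidef := by
  obtain ⟨A, hs, h0, -, rfl⟩ := hL
  refine .of_dotProduct_mulVec_nonneg ?_ fun v => ?_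
  · ext i j
    by_cases h : i = j
    · simp [h]
    · simp [h, Ne.symm h, hs.apply i j]
  · have hdirichlet : ∑ i, ∑ j, A i j * (v i - v j) ^ 2 = 2 * (star v ⬝ᵥ
        (Matrix.diagonal (fun i => ∑ j, A i j) - A) *ᵥ v) := by
      have h1 : ∑ i, ∑ j, A i j * v j ^ 2 = ∑ i, ∑ j, A i j * v i ^ 2 := by
        rw [Finset.sum_comm]
        simp only [hs.apply]
      have h2 : ∑ i, ∑ j, A i j * (v i - v j) ^ 2 = ∑ i, ∑ j, A i j * v i ^ 2
          + ∑ i, ∑ j, A i j * v j ^ 2 - 2 * ∑ i, ∑ j, A i j * (v i * v j) := by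
        simp only [Finset.mul_sum, ← Finset.sum_add_distrib, ← Finset.sum_sub_distrib]
        exact Finset.sum_congr rfl fun i _ => Finset.sum_congr rfl fun j _ => by ring
      rw [h2, h1, Matrix.sub_mulVec, dotProduct_sub]
      simp only [_root_.dotProduct, Matrix.mulVec_diagonal, star_trivial]
      simp only [_root_.dotProduct, Matrix.mulVec,
        Finset.mul_sum, Finset.sum_mul, ← Finset.sum_add_distrib, ← Finset.sum_sub_distrib]
      exact Finset.sum_congr rfl fun i _ => Finset.sum_congr rfl fun j _ => by ring
    have : 0 ≤ ∑ i, ∑ j, A i j * (v i - v j) ^ 2 :=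
      Finset.sum_nonneg fun i _ => Finset.sum_nonneg fun j _ => mul_nonneg (h0 i j) (sq_nonneg _)
    linarith

lemma IsConnLaplacian.transpose_eq {N : ℕ} {L : Matrix (Fin N) (Fin N) ℝ}
    (hL : IsConnLaplacian L) :
    Lᵀ = L := by
  simpa using hL.1.posSemidef.1.eq

lemma IsConnLaplacian.posDef_add_ones {N : ℕ} {L : Matrix (Fin N) (Fin N) ℝ}
    (hL : IsConnLaplacian L) : (L + vecMulVec 1 1).PosDef := by
  have hones : (vecMulVec (1 : Fin N → ℝ) 1).PosSemidef := by
    simpa using posSemidef_vecMulVec_self_star (1 : Fin N → ℝ)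
  have hsum := hL.1.posSemidef.add hones
  refine .of_dotProduct_mulVec_pos hsum.1 fun v hv => ?_
  refine (hsum.dotProduct_mulVec_nonneg v).lt_of_ne fun h => hv ?_
  have h1 := hL.1.posSemidef.dotProduct_mulVec_nonneg v
  have h2 := hones.dotProduct_mulVec_nonneg v
  rw [Matrix.add_mulVec, dotProduct_add] at h
  obtain ⟨c, rfl⟩ := hL.2 v ((hL.1.posSemidef.dotProduct_mulVec_zero_iff v).1 (by linarith))
  have h3 := (hones.dotProduct_mulVec_zero_iff _).1 (show _ = (0 : ℝ) by linarith)
  ext i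
  have : NeZero N := ⟨by rintro rfl; exact i.elim0⟩
  rw [vecMulVec_mulVec] at h3
  simpa [_root_.dotProduct, NeZero.ne N] using congrFun h3 i

/-- Up to the projection onto the mean, `L + U` with `U` the all-ones matrix has the same inverse
as `L`. -/
lemma IsConnLaplacian.mul_inv_add_ones {N : ℕ} {L : Matrix (Fin N) (Fin N) ℝ} (hN : N ≠ 0)
    (hL : IsConnLaplacian L) :
    L * (L + vecMulVec 1 1)⁻¹ = 1 - (N : ℝ)⁻¹ • vecMulVec 1 1 := by
  have hunit := (Matrix.isUnit_iff_isUnit_det _).1 hL.posDef_add_ones.isUnit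
  have hN' : (N : ℝ) ≠ 0 := Nat.cast_ne_zero.2 hN
  have hleft : vecMulVec 1 1 * L = 0 := by
    rw [vecMulVec_mul, ← Matrix.mulVec_transpose, hL.transpose_eq, hL.1.mulVec_one, vecMulVec_zero]
  have hsq : vecMulVec (1 : Fin N → ℝ) (1 : Fin N → ℝ) * vecMulVec 1 1
      = (N : ℝ) • vecMulVec 1 1 := by
    ext i j
    simp [Matrix.mul_apply]
  have hU : vecMulVec (1 : Fin N → ℝ) 1 * (L + vecMulVec 1 1)⁻¹ = (N : ℝ)⁻¹ • vecMulVec 1 1 := by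
    rw [← Matrix.mul_nonsing_inv_cancel_right _ ((N : ℝ)⁻¹ • vecMulVec 1 1) hunit,
      Matrix.smul_mul, Matrix.mul_add, hleft, hsq, zero_add, inv_smul_smul₀ hN']
  rw [← hU, ← Matrix.mul_nonsing_inv _ hunit, Matrix.add_mul, add_sub_cancel_right]

/-- Stability of `e' = M e + w`, `w' = -S e` when `M` has negative definite symmetric part, along
trajectories on which the positive definite `P` inverts `Sᵀ`. -/
lemma tendsto_zero_and_bounded_of_posDef {ι : Type*} [Fintype ι] {M S P : Matrix ι ι ℝ}
    (hM : (-(M + Mᵀ)).PosDef) (hP : P.PosDef) {e w : ℝ → ι → ℝ}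
    (he : ∀ t ∈ Ici (0 : ℝ), HasDerivWithinAt e (M *ᵥ e t + w t) (Ici 0) t)
    (hw : ∀ t ∈ Ici (0 : ℝ), HasDerivWithinAt w (-(S *ᵥ e t)) (Ici 0) t)
    (hSP : ∀ t ∈ Ici (0 : ℝ), Sᵀ *ᵥ P *ᵥ w t = w t) :
    Tendsto e atTop (𝓝 0) ∧ ∃ W : ℝ, ∀ t ∈ Ici (0 : ℝ), ‖w t‖ ≤ W := by
  obtain ⟨c, hc, hcM⟩ := hM.exists_pos_mul_dotProduct_le
  obtain ⟨d, hd, hdP⟩ := hP.exists_pos_mul_dotProduct_le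
  obtain ⟨C, hC, hCM⟩ := (Mᵀ * M).exists_dotProduct_mulVec_le
  have hMsym : ∀ v, 2 * (v ⬝ᵥ M *ᵥ v) ≤ -c * (v ⬝ᵥ v) := fun v => by
    have h1 := hcM v
    have h2 : v ⬝ᵥ Mᵀ *ᵥ v = v ⬝ᵥ M *ᵥ v := by
      rw [Matrix.mulVec_transpose, dotProduct_comm, ← dotProduct_mulVec]
    rw [Matrix.neg_mulVec, Matrix.add_mulVec, dotProduct_neg, dotProduct_add, h2] at h1
    linarith
  have hf := fun t ht => (he t ht).dotProduct (he t ht)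
  have hV := fun t ht => (hf t ht).add ((hw t ht).dotProduct ((hw t ht).const_mulVec P))
  have hVf : ∀ t ∈ Ici (0 : ℝ),
      (M *ᵥ e t + w t) ⬝ᵥ e t + e t ⬝ᵥ (M *ᵥ e t + w t) +
        (-(S *ᵥ e t) ⬝ᵥ P *ᵥ w t + w t ⬝ᵥ P *ᵥ (-(S *ᵥ e t))) ≤ -c * (e t ⬝ᵥ e t) := by
    intro t ht
    have h1 : S *ᵥ e t ⬝ᵥ P *ᵥ w t = e t ⬝ᵥ w t := by
      rw [dotProduct_comm, dotProduct_mulVec, ← Matrix.mulVec_transpose, hSP t ht, dotProduct_comm]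
    have h2 : w t ⬝ᵥ P *ᵥ (S *ᵥ e t) = S *ᵥ e t ⬝ᵥ P *ᵥ w t := by
      rw [dotProduct_mulVec, ← Matrix.mulVec_transpose, show Pᵀ = P by simpa using hP.1.eq,
        dotProduct_comm]
    have h3 := hMsym (e t)
    rw [dotProduct_comm _ (e t), dotProduct_add, Matrix.mulVec_neg, neg_dotProduct,
      dotProduct_neg, h2, h1]
    linarith
  have hwP : ∀ t, 0 ≤ w t ⬝ᵥ P *ᵥ w t := fun t => hP.posSemidef.dotProduct_mulVec_nonneg (w t)
  have hanti := antitoneOn_Ici_of_hasDerivWithinAt le_rfl hV fun t ht =>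
    (hVf t ht).trans (by nlinarith [dotProduct_self_nonneg_real (e t)])
  set V₀ := e 0 ⬝ᵥ e 0 + w 0 ⬝ᵥ P *ᵥ w 0 with hV₀
  have hbound : ∀ t ∈ Ici (0 : ℝ), e t ⬝ᵥ e t + w t ⬝ᵥ P *ᵥ w t ≤ V₀ :=
    fun t ht => hanti self_mem_Ici ht ht
  have hV₀0 : 0 ≤ V₀ := add_nonneg (dotProduct_self_nonneg_real _) (hwP 0)
  have hebound : ∀ t ∈ Ici (0 : ℝ), e t ⬝ᵥ e t ≤ V₀ := fun t ht => by
    linarith [hbound t ht, hwP t]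
  have hwbound : ∀ t ∈ Ici (0 : ℝ), w t ⬝ᵥ w t ≤ V₀ / d := fun t ht => by
    rw [le_div_iff₀ hd]
    linarith [hbound t ht, hdP (w t), dotProduct_self_nonneg_real (e t)]
  have hfK : ∀ t ∈ Ici (0 : ℝ), -(2 * V₀ + C * V₀ + V₀ / d + 1) ≤
      (M *ᵥ e t + w t) ⬝ᵥ e t + e t ⬝ᵥ (M *ᵥ e t + w t) := by
    intro t ht
    have h1 := dotProduct_self_nonneg_real (M *ᵥ e t + e t)
    have h2 := dotProduct_self_nonneg_real (w t + e t)
    have h3 := hCM (e t)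
    have h4 := mul_le_mul_of_nonneg_left (hebound t ht) hC
    have h5 : e t ⬝ᵥ (Mᵀ * M) *ᵥ e t = M *ᵥ e t ⬝ᵥ M *ᵥ e t := by
      rw [← Matrix.mulVec_mulVec, Matrix.mulVec_transpose, dotProduct_comm, ← dotProduct_mulVec]
    rw [dotProduct_comm _ (e t), dotProduct_add]
    simp only [add_dotProduct, dotProduct_add, dotProduct_comm _ (e t)] at h1 h2
    linarith [hebound t ht, hwbound t ht]
  have hlim := tendsto_zero_of_lyapunov hc (show 0 < 2 * V₀ + C * V₀ + V₀ / d + 1 by positivity)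
    (fun t _ => add_nonneg (dotProduct_self_nonneg_real (e t)) (hwP t))
    (fun t _ => dotProduct_self_nonneg_real (e t)) hV hf hVf hfK
  refine ⟨tendsto_pi_nhds.2 fun i => ?_, √(V₀ / d), fun t ht => ?_⟩
  · have hsq := squeeze_zero (fun t => sq_nonneg (e t i))
      (fun t => sq_apply_le_dotProduct_self (e t) i) hlim
    have := hsq.sqrt
    simp only [Real.sqrt_sq_eq_abs, Real.sqrt_zero] at this
    exact (tendsto_zero_iff_abs_tendsto_zero _).2 this
  · refine (pi_norm_le_iff_of_nonneg (Real.sqrt_nonneg _)).2 fun i => ?_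
    exact Real.abs_le_sqrt ((sq_apply_le_dotProduct_self (w t) i).trans (hwbound t ht))

lemma isUnit_of_isHurwitz {n : ℕ} {A : Matrix (Fin n) (Fin n) ℝ} (hA : IsHurwitz A) :
    IsUnit A := by
  rw [Matrix.isUnit_iff_isUnit_det, isUnit_iff_ne_zero]
  intro hdet
  refine (hA 0 ?_).false
  rw [spectrum.zero_mem_iff, Matrix.isUnit_iff_isUnit_det, isUnit_iff_ne_zero, not_not]
  exact (Complex.ofRealHom.map_det A).symm.trans (by rw [hdet, map_zero])

lemma kronecker_one_mulVec_const {N n : ℕ} {L : Matrix (Fin N) (Fin N) ℝ} (hL : L *ᵥ 1 = 0)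
    (y : Fin n → ℝ) :
    (L ⊗ₖ (1 : Matrix (Fin n) (Fin n) ℝ)) *ᵥ (fun p => y p.2) = 0 := by
  ext ⟨i, k⟩
  have h : ∑ j, L i j = 0 := by simpa [Matrix.mulVec, _root_.dotProduct] using congrFun hL i
  simp [Matrix.mulVec, _root_.dotProduct, Fintype.sum_prod_type, Matrix.one_apply,
    ← Finset.sum_mul, h]

lemma one_kronecker_mulVec_const {N n : ℕ} (A : Matrix (Fin n) (Fin n) ℝ) (y : Fin n → ℝ) :
    ((1 : Matrix (Fin N) (Fin N) ℝ) ⊗ₖ A) *ᵥ (fun p => y p.2) = fun p => (A *ᵥ y) p.2 := by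
  ext ⟨i, k⟩
  simp [Matrix.mulVec, _root_.dotProduct, Fintype.sum_prod_type, Matrix.one_apply]

lemma ones_kronecker_one_mulVec {N n : ℕ} (w : Fin N × Fin n → ℝ) :
    (vecMulVec (1 : Fin N → ℝ) (1 : Fin N → ℝ) ⊗ₖ (1 : Matrix (Fin n) (Fin n) ℝ)) *ᵥ w =
      fun p => ∑ j, w (j, p.2) := by
  ext ⟨i, k⟩
  simp [Matrix.mulVec, _root_.dotProduct, Fintype.sum_prod_type, Matrix.one_apply]

lemma posDef_neg_closed_loop {N n : ℕ} {A : Matrix (Fin n) (Fin n) ℝ}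
    (hA : (-(A + Aᵀ)).PosDef) {LC LP : Matrix (Fin N) (Fin N) ℝ} (hLC : IsConnLaplacian LC)
    (hLP : IsConnLaplacian LP) {σ σP : ℝ} (hσ : 0 ≤ σ) (hσP : 0 ≤ σP) :
    let M := ((1 : Matrix (Fin N) (Fin N) ℝ) ⊗ₖ A) -
          (σ • (LC ⊗ₖ (1 : Matrix (Fin n) (Fin n) ℝ)) +
            σP • (LP ⊗ₖ (1 : Matrix (Fin n) (Fin n) ℝ)))
    (-(M + Mᵀ)).PosDef := by
  intro M
  have hpsd := ((hLC.1.posSemidef.kronecker (.one (n := Fin n))).smul hσ).add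
    ((hLP.1.posSemidef.kronecker (.one (n := Fin n))).smul hσP)
  have hpd := ((Matrix.PosDef.one (n := Fin N)).kronecker hA).add_posSemidef (hpsd.add hpsd)
  have hT : ∀ {L : Matrix (Fin N) (Fin N) ℝ}, IsConnLaplacian L →
      (L ⊗ₖ (1 : Matrix (Fin n) (Fin n) ℝ))ᵀ = L ⊗ₖ (1 : Matrix (Fin n) (Fin n) ℝ) := fun hL => by
    rw [← kroneckerMap_transpose, hL.transpose_eq, Matrix.transpose_one]
  have hAT : ((1 : Matrix (Fin N) (Fin N) ℝ) ⊗ₖ (-(A + Aᵀ))) =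
      -(((1 : Matrix (Fin N) (Fin N) ℝ) ⊗ₖ A) + ((1 : Matrix (Fin N) (Fin N) ℝ) ⊗ₖ A)ᵀ) := by
    rw [← kroneckerMap_transpose, Matrix.transpose_one, ← kronecker_add]
    ext
    simp only [kroneckerMap_apply, Matrix.neg_apply, Matrix.add_apply]
    ring
  refine (congrArg Matrix.PosDef ?_).mpr hpd
  simp only [M, hAT, Matrix.transpose_sub, Matrix.transpose_add, Matrix.transpose_smul, hT hLC,
    hT hLP]
  abel

/-- Corollary for homogeneous networks: if all agents share the same dynamics
`A`, with `A` and `A + Aᵀ` Hurwitz (`A + Aᵀ` negative definite), then for any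
connected control layers and any gains `σ ≥ 0`, `σ_P > 0`, `σ_I > 0`, every
trajectory of the closed-loop network converges to `𝟙_N ⊗ x_∞` with
`x_∞ = −(1/N)·A⁻¹·Σ b_k`, and `z` remains bounded. -/
theorem stmt_14 {N n : ℕ} (hN : 2 ≤ N) (hn : 1 ≤ n)
    (A : Matrix (Fin n) (Fin n) ℝ)
    (hA : IsHurwitz A)
    (hA2 : (-(A + A.transpose)).PosDef)
    (b : Fin N → Fin n → ℝ)
    (LC LP LI : Matrix (Fin N) (Fin N) ℝ)
    (hLC : IsConnLaplacian LC) (hLP : IsConnLaplacian LP)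
    (hLI : IsConnLaplacian LI)
    (σ σP σI : ℝ) (hσ : 0 ≤ σ) (hσP : 0 < σP) (hσI : 0 < σI)
    (x z : ℝ → Fin N × Fin n → ℝ)
    (hx : ∀ t ∈ Set.Ici (0 : ℝ), HasDerivWithinAt x
      ((((1 : Matrix (Fin N) (Fin N) ℝ) ⊗ₖ A) -
          (σ • (LC ⊗ₖ (1 : Matrix (Fin n) (Fin n) ℝ)) +
            σP • (LP ⊗ₖ (1 : Matrix (Fin n) (Fin n) ℝ)))).mulVec (x t) +
        z t + fun p => b p.1 p.2) (Set.Ici 0) t)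
    (hz : ∀ t ∈ Set.Ici (0 : ℝ), HasDerivWithinAt z
      (-(σI • ((LI ⊗ₖ (1 : Matrix (Fin n) (Fin n) ℝ)).mulVec (x t))))
      (Set.Ici 0) t)
    (hz0 : z 0 = 0) :
    Filter.Tendsto x Filter.atTop
      (nhds (fun p => (-((1 / (N : ℝ)) • (A⁻¹.mulVec (∑ k, b k)))) p.2)) ∧
    ∃ W : ℝ, ∀ t ∈ Set.Ici (0 : ℝ), ‖z t‖ ≤ W := by
  have hN0 : N ≠ 0 := by omega
  have hNR : (N : ℝ) ≠ 0 := Nat.cast_ne_zero.2 hN0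
  set M := ((1 : Matrix (Fin N) (Fin N) ℝ) ⊗ₖ A) -
          (σ • (LC ⊗ₖ (1 : Matrix (Fin n) (Fin n) ℝ)) +
            σP • (LP ⊗ₖ (1 : Matrix (Fin n) (Fin n) ℝ))) with hM
  set y : Fin n → ℝ := -((1 / (N : ℝ)) • (A⁻¹.mulVec (∑ k, b k))) with hy
  set xe : Fin N × Fin n → ℝ := fun p => y p.2 with hxe
  set ze : Fin N × Fin n → ℝ := -(fun p => (A *ᵥ y) p.2) - fun p => b p.1 p.2 with hze
  set U : Matrix (Fin N) (Fin N) ℝ := vecMulVec 1 1 with hU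
  set S : Matrix (Fin N × Fin n) (Fin N × Fin n) ℝ :=
    σI • (LI ⊗ₖ (1 : Matrix (Fin n) (Fin n) ℝ)) with hS
  set P : Matrix (Fin N × Fin n) (Fin N × Fin n) ℝ :=
    σI⁻¹ • ((LI + U)⁻¹ ⊗ₖ (1 : Matrix (Fin n) (Fin n) ℝ)) with hP
  have hMxe : M *ᵥ xe = fun p => (A *ᵥ y) p.2 := by
    simp only [hM, hxe, Matrix.sub_mulVec, Matrix.add_mulVec, Matrix.smul_mulVec,
      kronecker_one_mulVec_const hLC.1.mulVec_one, kronecker_one_mulVec_const hLP.1.mulVec_one,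
      one_kronecker_mulVec_const, smul_zero, add_zero, sub_zero]
  have hSxe : S *ᵥ xe = 0 := by
    rw [hS, Matrix.smul_mulVec, kronecker_one_mulVec_const hLI.1.mulVec_one, smul_zero]
  have hAy : A *ᵥ y = -((N : ℝ)⁻¹ • ∑ k, b k) := by
    rw [hy, Matrix.mulVec_neg, Matrix.mulVec_smul, Matrix.mulVec_mulVec,
      Matrix.mul_nonsing_inv _ ((Matrix.isUnit_iff_isUnit_det _).1 (isUnit_of_isHurwitz hA)),
      Matrix.one_mulVec, one_div]
  have hUze : (U ⊗ₖ (1 : Matrix (Fin n) (Fin n) ℝ)) *ᵥ ze = 0 := by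
    rw [hU, ones_kronecker_one_mulVec]
    ext p
    simp [hze, hAy, Finset.sum_sub_distrib, mul_inv_cancel_left₀ hNR]
  have hUz : ∀ t ∈ Ici (0 : ℝ), (U ⊗ₖ (1 : Matrix (Fin n) (Fin n) ℝ)) *ᵥ z t = 0 := by
    have hUS : (U ⊗ₖ (1 : Matrix (Fin n) (Fin n) ℝ)) * (LI ⊗ₖ (1 : Matrix (Fin n) (Fin n) ℝ))
        = 0 := by
      rw [← mul_kronecker_mul, hU, vecMulVec_mul, ← Matrix.mulVec_transpose, hLI.transpose_eq,
        hLI.1.mulVec_one, vecMulVec_zero, zero_kronecker]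
    have hderiv : ∀ t ∈ Ici (0 : ℝ), HasDerivWithinAt
        (fun t => (U ⊗ₖ (1 : Matrix (Fin n) (Fin n) ℝ)) *ᵥ z t) 0 (Ici 0) t := fun t ht => by
      convert (hz t ht).const_mulVec (U ⊗ₖ (1 : Matrix (Fin n) (Fin n) ℝ)) using 1
      rw [Matrix.mulVec_neg, Matrix.mulVec_smul, Matrix.mulVec_mulVec, hUS, Matrix.zero_mulVec,
        smul_zero, neg_zero]
    intro t ht
    have hconst := constant_of_has_deriv_right_zero
      (fun s hs => ((hderiv s hs.1).mono Icc_subset_Ici_self).continuousWithinAt)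
      (fun s hs => (hderiv s hs.1).mono (Ici_subset_Ici.2 hs.1)) t (right_mem_Icc.2 ht)
    simpa [hz0] using hconst
  have hSP : ∀ t ∈ Ici (0 : ℝ), Sᵀ *ᵥ P *ᵥ (z t - ze) = z t - ze := by
    intro t ht
    rw [hS, hP, Matrix.mulVec_mulVec, Matrix.transpose_smul, ← kroneckerMap_transpose,
      hLI.transpose_eq, Matrix.transpose_one, Matrix.smul_mul, Matrix.mul_smul,
      smul_inv_smul₀ hσI.ne', ← mul_kronecker_mul, hLI.mul_inv_add_ones hN0, Matrix.one_mul,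
      sub_eq_add_neg, ← neg_smul, add_kronecker, one_kronecker_one, smul_kronecker,
      Matrix.add_mulVec, Matrix.one_mulVec, Matrix.smul_mulVec, Matrix.mulVec_sub, hUz t ht, hUze,
      sub_zero, smul_zero, add_zero]
  obtain ⟨hlim, W, hW⟩ := tendsto_zero_and_bounded_of_posDef (S := S) (P := P)
    (e := fun t => x t - xe) (w := fun t => z t - ze)
    (posDef_neg_closed_loop hA2 hLC hLP hσ hσP.le)
    ((hLI.posDef_add_ones.inv.kronecker .one).smul (inv_pos.2 hσI))
    (fun t ht => by
      refine ((hx t ht).sub_const xe).congr_deriv ?_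
      rw [Matrix.mulVec_sub, hMxe, hze]
      abel)
    (fun t ht => by
      refine ((hz t ht).sub_const ze).congr_deriv ?_
      rw [Matrix.mulVec_sub, hSxe, sub_zero, hS, Matrix.smul_mulVec])
    hSP
  refine ⟨by simpa using hlim.add_const xe, W + ‖ze‖, fun t ht => ?_⟩
  have := norm_le_norm_sub_add (z t) ze
  linarith [hW t ht]

end
end
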